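/- For all integers p ≥ 1 and q ≥ 3, if χ_s(UC_q □ BC_{2p+1}) ≤ 4, then UC_q □ BC_{2p+1} admits a homomorphism of signed graphs to K₄^mixed, the complete signed graph on 4 vertices with exactly one negative edge. -/

import Mathlib

open SimpleGraph

/-- Two signatures on a graph `G` are equivalent (`σ₂` is obtained from `σ₁` by
switching the set of vertices `{v | s v = true}`); signs are encoded by `Bool`,
with `true` meaning negative, so that the product of signs is `xor`. -/
def SigEquiv {V : Type*} (G : SimpleGraph V) (σ₁ σ₂ : V → V → Bool) : Prop :=
  ∃ s : V → Bool, ∀ u v, G.Adj u v → σ₂ u v = xor (σ₁ u v) (xor (s u) (s v))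

/-- A homomorphism of signed graphs `(G, σ) → (H, π)`: a graph homomorphism
mapping some switching-equivalent signature of `σ` to `π`. -/
def SHom {V W : Type*} (G : SimpleGraph V) (σ : V → V → Bool)
    (H : SimpleGraph W) (π : W → W → Bool) : Prop :=
  ∃ (φ : G →g H) (σ' : V → V → Bool),
    SigEquiv G σ σ' ∧ ∀ u v, G.Adj u v → π (φ u) (φ v) = σ' u v

/-- The chromatic number of a signed graph: the least number of vertices of a
signed graph to which it admits a homomorphism of signed graphs. -/
noncomputable def sChrom {V : Type*} (G : SimpleGraph V) (σ : V → V → Bool) : ℕ :=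
  sInf {n : ℕ | ∃ (H : SimpleGraph (Fin n)) (π : Fin n → Fin n → Bool), SHom G σ H π}

/-- The signature of the Cartesian (box) product of two signed graphs:
a copy of an edge of `H` inside a `G`-fiber keeps its sign, and vice versa. -/
def prodSign {V W : Type*} [DecidableEq V] (σ : V → V → Bool) (π : W → W → Bool)
    (p q : V × W) : Bool :=
  if p.1 = q.1 then π p.2 q.2 else σ p.1 q.1

/-- The successor of a vertex of the cycle on `Fin n`. -/
def cycleSucc {n : ℕ} (i : Fin n) : Fin n :=
  ⟨(i.val + 1) % n, Nat.mod_lt _ (Nat.lt_of_le_of_lt (Nat.zero_le _) i.isLt)⟩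

/-- A signature on the cycle of length `n` is balanced when the number of
negative edges is even, i.e. the product of the signs of its edges is `+1`. -/
def BalancedCycleSign (n : ℕ) (σ : Fin n → Fin n → Bool) : Prop :=
  (Finset.univ.filter (fun i : Fin n => σ i (cycleSucc i) = true)).card % 2 = 0

/-- The signature of `K₄^mixed`: the complete graph on four vertices with
exactly one negative edge (the edge `01`). -/
def K4mixedSign : Fin 4 → Fin 4 → Bool :=
  fun u v => (u == 0 && v == 1) || (u == 1 && v == 0)

theorem cycleSucc_eq_add_one {n : ℕ} (i : Fin (n + 2)) : cycleSucc i = i + 1 := by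
  ext
  simp [cycleSucc, Fin.val_add]

theorem cycleGraph_adj_cycleSucc {n : ℕ} (hn : 2 ≤ n) (i : Fin n) :
    (cycleGraph n).Adj i (cycleSucc i) := by
  obtain ⟨m, rfl⟩ := Nat.exists_eq_add_of_le' hn
  rw [cycleSucc_eq_add_one, cycleGraph_adj]
  simp

/-- A signature on an `n`-cycle that is switching-equivalent to the constant signature `c`
has as many negative edges, modulo two, as the constant signature. -/
theorem card_neg_cycle_mod_two {n : ℕ} (hn : 2 ≤ n) (σ : Fin n → Fin n → Bool)
    (c : Bool) (r : Fin n → Bool)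
    (h : ∀ i, σ i (cycleSucc i) = xor c (xor (r i) (r (cycleSucc i)))) :
    (Finset.univ.filter (fun i : Fin n => σ i (cycleSucc i) = true)).card % 2 =
      n * c.toNat % 2 := by
  obtain ⟨m, rfl⟩ := Nat.exists_eq_add_of_le' hn
  let f : Bool → ZMod 2 := fun b => b.toNat
  have hf : ∀ a b c : Bool, (if xor a (xor b c) = true then 1 else 0) = f a + (f b + f c) := by
    decide
  have hrot : ∑ i, f (r (cycleSucc i)) = ∑ i, f (r i) := by
    simp only [cycleSucc_eq_add_one]
    exact Equiv.sum_comp (Equiv.addRight (1 : Fin (m + 2))) (fun i => f (r i))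
  refine (ZMod.natCast_eq_natCast_iff' _ _ 2).1 ?_
  rw [Finset.natCast_card_filter]
  simp only [h, hf, Finset.sum_add_distrib, hrot, CharTwo.add_self_eq_zero]
  simp [f]

/-- The symmetric signature on `Fin 4` with the prescribed signs of the six edges. -/
def signFin4 (a b c d e f : Bool) : Fin 4 → Fin 4 → Bool :=
  ![![false, a, b, c], ![a, false, d, e], ![b, d, false, f], ![c, e, f, false]]

theorem exists_signFin4_eq (π : Fin 4 → Fin 4 → Bool) (hπ : ∀ x y, π x y = π y x) :
    ∃ a b c d e f, ∀ x y, x ≠ y → π x y = signFin4 a b c d e f x y := by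
  refine ⟨π 0 1, π 0 2, π 0 3, π 1 2, π 1 3, π 2 3, fun x y hxy => ?_⟩
  fin_cases x <;> fin_cases y <;> first | exact absurd rfl hxy | rfl | exact hπ _ _

theorem signFin4_switching_classes : ∀ a b c d e f : Bool,
    (∃ (k : Bool) (t : Fin 4 → Bool), ∀ x y, x ≠ y →
      signFin4 a b c d e f x y = xor k (xor (t x) (t y))) ∨
    ∃ x₀ y₀ : Fin 4, x₀ ≠ y₀ ∧ ∃ t : Fin 4 → Bool, ∀ x y, x ≠ y →
      xor (signFin4 a b c d e f x y) (xor (t x) (t y)) =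
        ((x == x₀ && y == y₀) || (x == y₀ && y == x₀)) := by
  decide +kernel

theorem exists_perm_fin4 : ∀ x₀ y₀ : Fin 4, x₀ ≠ y₀ →
    ∃ e : Equiv.Perm (Fin 4), e x₀ = 0 ∧ e y₀ = 1 := by
  decide +kernel

/-- Every signed complete graph on four vertices is switching-equivalent to the all-positive one,
to the all-negative one, or to a copy of `K₄^mixed`. -/
theorem switching_classes_K4 (π : Fin 4 → Fin 4 → Bool) (hπ : ∀ x y, π x y = π y x) :
    (∃ (k : Bool) (t : Fin 4 → Bool), ∀ x y, x ≠ y → π x y = xor k (xor (t x) (t y))) ∨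
    ∃ (e : Equiv.Perm (Fin 4)) (t : Fin 4 → Bool), ∀ x y, x ≠ y →
      K4mixedSign (e x) (e y) = xor (π x y) (xor (t x) (t y)) := by
  obtain ⟨a, b, c, d, e, f, h⟩ := exists_signFin4_eq π hπ
  rcases signFin4_switching_classes a b c d e f with ⟨k, t, ht⟩ | ⟨x₀, y₀, hne, t, ht⟩
  · exact .inl ⟨k, t, fun x y hxy => (h x y hxy).trans (ht x y hxy)⟩
  · obtain ⟨g, hx, hy⟩ := exists_perm_fin4 x₀ y₀ hne
    refine .inr ⟨g, t, fun x y hxy => ?_⟩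
    rw [h x y hxy, ht x y hxy, K4mixedSign, ← hx, ← hy]
    simp only [Bool.beq_eq_decide_eq, g.injective.eq_iff]

/-- A signed graph of chromatic number at most `n` maps to a signed complete graph on `Fin n`. -/
theorem exists_sHom_of_sChrom_le {V : Type*} [Finite V] {G : SimpleGraph V}
    {σ : V → V → Bool} (hσ : ∀ u v, σ u v = σ v u) {n : ℕ} (h : sChrom G σ ≤ n) :
    ∃ (φ : V → Fin n) (s : V → Bool) (π : Fin n → Fin n → Bool), (∀ x y, π x y = π y x) ∧
      ∀ u v, G.Adj u v → φ u ≠ φ v ∧ π (φ u) (φ v) = xor (σ u v) (xor (s u) (s v)) := by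
  have hne : {n : ℕ | ∃ (H : SimpleGraph (Fin n)) (π : Fin n → Fin n → Bool),
      SHom G σ H π}.Nonempty := by
    obtain ⟨N, ⟨e⟩⟩ := Finite.exists_equiv_fin V
    refine ⟨N, G.map e.toEmbedding, fun x y => σ (e.symm x) (e.symm y),
      (SimpleGraph.Embedding.map e.toEmbedding G).toHom, σ, ⟨fun _ => false, by simp⟩, ?_⟩
    intro u v _
    change σ (e.symm (e u)) (e.symm (e v)) = σ u v
    simp
  obtain ⟨H, π, φ, σ', ⟨s, hs⟩, hφ⟩ := Nat.sInf_mem hne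
  classical
  refine ⟨fun v => Fin.castLE h (φ v), s, fun x y => decide (∃ u v, G.Adj u v ∧
    Fin.castLE h (φ u) = x ∧ Fin.castLE h (φ v) = y ∧ σ' u v = true), fun x y => ?_,
    fun u v huv => ⟨fun he => (φ.map_rel huv).ne (Fin.castLE_injective h he), ?_⟩⟩
  · have hσ' : ∀ u v, G.Adj u v → σ' u v = σ' v u := fun u v huv => by
      rw [hs u v huv, hs v u huv.symm, hσ, Bool.xor_comm (s u)]
    refine decide_eq_decide.2 ⟨?_, ?_⟩ <;> rintro ⟨u, v, huv, hu, hv, hneg⟩ <;>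
      exact ⟨v, u, huv.symm, hv, hu, hσ' u v huv ▸ hneg⟩
  · rw [← hs u v huv, Bool.eq_iff_iff, decide_eq_true_iff]
    refine ⟨?_, fun hneg => ⟨u, v, huv, rfl, rfl, hneg⟩⟩
    rintro ⟨u', v', huv', hu, hv, hneg⟩
    rw [← hφ u v huv, ← Fin.castLE_injective h hu, ← Fin.castLE_injective h hv, hφ u' v' huv', hneg]

/-- If `χ_s(UC_q □ BC_{2p+1}) ≤ 4` then `UC_q □ BC_{2p+1}` admits a
homomorphism of signed graphs to `K₄^mixed`. -/
theorem shom_K4mixed_of_chrom_le_four (p q : ℕ) (hp : 1 ≤ p) (hq : 3 ≤ q)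
    (σ₁ : Fin q → Fin q → Bool) (hσ₁ : ∀ u v, σ₁ u v = σ₁ v u)
    (hU : ¬ BalancedCycleSign q σ₁)
    (σ₂ : Fin (2 * p + 1) → Fin (2 * p + 1) → Bool)
    (hσ₂ : ∀ u v, σ₂ u v = σ₂ v u)
    (hBsign : BalancedCycleSign (2 * p + 1) σ₂)
    (hchrom : sChrom (cycleGraph q □ cycleGraph (2 * p + 1)) (prodSign σ₁ σ₂) ≤ 4) :
    SHom (cycleGraph q □ cycleGraph (2 * p + 1)) (prodSign σ₁ σ₂)
      (⊤ : SimpleGraph (Fin 4)) K4mixedSign := by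
  have hq₂ : 2 ≤ q := by omega
  have hp₂ : 2 ≤ 2 * p + 1 := by omega
  obtain ⟨φ, s, π, hπ, hφ⟩ := exists_sHom_of_sChrom_le (fun u v => by
    simp only [prodSign, hσ₁ u.1, hσ₂ u.2, eq_comm (a := u.1)]) hchrom
  rcases switching_classes_K4 π hπ with ⟨k, t, ht⟩ | ⟨e, t, ht⟩
  · exfalso
    have hadj : ∀ u v, (cycleGraph q □ cycleGraph (2 * p + 1)).Adj u v →
        prodSign σ₁ σ₂ u v = xor k (xor (xor (t (φ u)) (s u)) (xor (t (φ v)) (s v))) := by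
      intro u v huv
      have h := (hφ u v huv).2
      rw [ht _ _ (hφ u v huv).1] at h
      have hxor : ∀ x a b y c d : Bool, xor x (xor a b) = xor y (xor c d) →
          y = xor x (xor (xor a c) (xor b d)) := by decide
      exact hxor _ _ _ _ _ _ h
    have hU' := card_neg_cycle_mod_two hq₂ σ₁ k
      (fun i => xor (t (φ (i, 0))) (s (i, 0))) fun i => by
        have hi := cycleGraph_adj_cycleSucc hq₂ i
        rw [← hadj _ _ (boxProd_adj_left.2 hi), prodSign, if_neg hi.ne]
    have hB' := card_neg_cycle_mod_two hp₂ σ₂ k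
      (fun j => xor (t (φ (⟨0, by omega⟩, j))) (s (⟨0, by omega⟩, j))) fun j => by
        rw [← hadj _ _ (boxProd_adj_right.2 (cycleGraph_adj_cycleSucc hp₂ j)), prodSign, if_pos rfl]
    rw [BalancedCycleSign] at hU hBsign
    cases k <;> simp at hU' hB' <;> omega
  · refine ⟨⟨fun v => e (φ v), fun {u v} huv => e.injective.ne (hφ u v huv).1⟩,
      fun u v => K4mixedSign (e (φ u)) (e (φ v)),
      ⟨fun v => xor (t (φ v)) (s v), fun u v huv => ?_⟩, fun _ _ _ => rfl⟩
    dsimp only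
    rw [ht _ _ (hφ u v huv).1, (hφ u v huv).2]
    simp only [Bool.xor_assoc, Bool.xor_left_comm, Bool.xor_comm]
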